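/- Let H be a sparse numerical semigroup of genus g ≥ 4 with Frobenius number ℓ_g = 2g - 4. Then H is one of the following six semigroups: (1) {0, 3, 6} ∪ {n ≥ 9} (i.e., 3ℕ + H_8, genus 6); (2) {0, 3, 6, 9} ∪ {n ≥ 11} (i.e., 3ℕ + H_10, genus 7); (3) {0, 4} ∪ {n ≥ 7} (i.e., 4ℕ + H_6, genus 5); (4) {0} ∪ {n ≥ 5} (i.e., H_4, genus 4); (5) {0, 5} ∪ {n ≥ 7} (i.e., 5ℕ + H_6, genus 5); (6) {0, 5, 7} ∪ {n ≥ 9} (i.e., {0,5,7} ∪ H_8, genus 6). -/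

import Mathlib

/-- `H` is a numerical semigroup of genus `g`: it contains `0`, is closed under
addition, and its complement in `ℕ` (the set of gaps) is finite with exactly
`g` elements. -/
def IsNumericalSemigroupOfGenus (H : Set ℕ) (g : ℕ) : Prop :=
  0 ∈ H ∧ (∀ a ∈ H, ∀ b ∈ H, a + b ∈ H) ∧ Hᶜ.Finite ∧ Hᶜ.ncard = g

/-- The `i`-th gap `ℓ_i` of `H` (1-indexed): the `i`-th smallest element of `ℕ \ H`.
In particular, if `H` has genus `g`, then `gap H g` is the Frobenius number of `H`. -/
noncomputable def gap (H : Set ℕ) (i : ℕ) : ℕ :=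
  Nat.nth (fun n => n ∉ H) (i - 1)

/-- A numerical semigroup `H` of genus `g` is sparse if any two subsequent gaps
differ by at most `2`. -/
def IsSparse (H : Set ℕ) (g : ℕ) : Prop :=
  ∀ i, 1 ≤ i → i ≤ g - 1 → gap H (i + 1) - gap H i ≤ 2

/-- `D`, the number of double leaps of `H` (of genus `g`). -/
noncomputable def numDouble (H : Set ℕ) (g : ℕ) : ℕ :=
  {i : ℕ | 1 ≤ i ∧ i ≤ g - 1 ∧ gap H (i + 1) - gap H i = 2}.ncard

/-- `S`, the number of single leaps of `H` (of genus `g`). -/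
noncomputable def numSingle (H : Set ℕ) (g : ℕ) : ℕ :=
  {i : ℕ | 1 ≤ i ∧ i ≤ g - 1 ∧ gap H (i + 1) - gap H i = 1}.ncard

lemma gap_not_mem {H : Set ℕ} (hfin : Hᶜ.Finite) {i : ℕ} (hi : i - 1 < Hᶜ.ncard) :
    gap H i ∉ H := by
  have hfin' : (Set.ofPred fun n => n ∉ H).Finite := hfin
  refine Nat.nth_mem (p := fun n => n ∉ H) _ fun hf => ?_
  rwa [Set.ncard_eq_toFinset_card _ hfin] at hi

lemma mem_of_frobenius_lt {H : Set ℕ} (hfin : Hᶜ.Finite) {n : ℕ}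
    (hn : gap H Hᶜ.ncard < n) : n ∈ H := by
  by_contra h
  obtain ⟨i, hi, rfl⟩ := Nat.exists_lt_card_nth_eq (p := fun n => n ∉ H) h
  have hi' := hi hfin
  have hc : Hᶜ.ncard = (Set.Finite.toFinset hfin).card := Set.ncard_eq_toFinset_card _ hfin
  have : Nat.nth (fun n => n ∉ H) i ≤ Nat.nth (fun n => n ∉ H) (Hᶜ.ncard - 1) :=
    Nat.nth_le_nth_of_lt_card hfin (by omega) (by
      change _ < (Set.Finite.toFinset hfin).card
      omega)
  exact absurd hn (not_lt.mpr this)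

/-- A sparse semigroup has no two consecutive elements below its Frobenius number. -/
lemma succ_not_mem_of_isSparse {H : Set ℕ} {g : ℕ} (hfin : Hᶜ.Finite) (hc : Hᶜ.ncard = g)
    (hs : IsSparse H g) (h1 : 1 ∉ H) {x : ℕ} (hx : x < gap H g) (hxH : x ∈ H) : x + 1 ∉ H := by
  classical
  intro hx1
  have hcard : (Set.Finite.toFinset hfin).card = g := by
    rw [← Set.ncard_eq_toFinset_card _ hfin, hc]
  have hg : 0 < g := by
    rw [← hc, Set.ncard_pos hfin]
    exact ⟨1, h1⟩
  have hF : gap H g ∉ H := gap_not_mem hfin (by omega)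
  have hpos : 1 < x := by
    rcases Nat.lt_or_ge 1 x with h | h
    · exact h
    · interval_cases x <;> exact absurd ‹_› h1
  set i := Nat.count (fun n => n ∉ H) x with hi
  have hi0 : 1 ≤ i := by
    rw [hi, Nat.one_le_iff_ne_zero, Nat.count_ne_iff_exists]
    exact ⟨1, hpos, h1⟩
  have hig : i ≤ g - 1 := by
    by_contra hlt
    have : Nat.nth (fun n => n ∉ H) (g - 1) < x := Nat.nth_lt_of_lt_count (by omega)
    exact absurd hx (not_lt.mpr this.le)
  have hlow : gap H i < x := Nat.nth_lt_of_lt_count (by omega)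
  have hhigh : x ≤ gap H (i + 1) := by
    rw [gap, Nat.add_sub_cancel, hi]
    exact Nat.le_nth_count' ⟨gap H g, hF, hx.le⟩
  have hmem : gap H (i + 1) ∉ H := gap_not_mem hfin (by omega)
  have hne : gap H (i + 1) ≠ x := fun h => hmem (h ▸ hxH)
  have hne' : gap H (i + 1) ≠ x + 1 := fun h => hmem (h ▸ hx1)
  have := hs i hi0 hig
  omega

open Finset in
/-- If `F + 1 = 2 * s + 3`, where `s` elements of `H` are at most `F`, and no two elements of `H`
add up to `F`, then exactly three numbers `x ≤ F` are such that `x` and `F - x` are both gaps. -/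
lemma card_self_dual_gaps {H : Set ℕ} [DecidablePred (· ∈ H)] {F s : ℕ}
    (hsum : ∀ x ≤ F, x ∈ H → F - x ∉ H)
    (hs : #{x ∈ range (F + 1) | x ∈ H} = s) :
    #{x ∈ range (F + 1) | x ∉ H ∧ F - x ∉ H} + 2 * s = F + 1 := by
  have hr : #{x ∈ range (F + 1) | F - x ∈ H} = s := by
    rw [← hs, card_filter, card_filter]
    exact sum_flip (fun x => if x ∈ H then 1 else 0)
  have h : ∑ x ∈ range (F + 1), ((if x ∉ H ∧ F - x ∉ H then 1 else 0) +
      ((if x ∈ H then 1 else 0) + (if F - x ∈ H then 1 else 0))) =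
      ∑ x ∈ range (F + 1), 1 := by
    refine sum_congr rfl fun x hx => ?_
    have := hsum x (by simpa [Nat.lt_succ_iff] using hx)
    by_cases h1 : x ∈ H <;> by_cases h2 : F - x ∈ H <;> simp_all
  rw [sum_add_distrib, sum_add_distrib, ← card_filter, ← card_filter, ← card_filter, hs, hr] at h
  simp at h
  omega

open Finset in
lemma card_filter_mem_add_ncard_compl {H : Set ℕ} [DecidablePred (· ∈ H)] {F : ℕ}
    (hF : ∀ n, F < n → n ∈ H) : #{x ∈ range (F + 1) | x ∈ H} + Hᶜ.ncard = F + 1 := by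
  have : Hᶜ = ↑({x ∈ range (F + 1) | ¬ x ∈ H} : Finset ℕ) := by
    ext n
    have := hF n
    simp only [Set.mem_compl_iff, coe_filter, mem_range, Set.mem_ofPred_eq]
    grind
  rw [this, Set.ncard_coe_finset, card_filter_add_card_filter_not, card_range]

open Finset in
/-- If the Frobenius number `2 * k` equals `2 * g - 4`, then apart from `k` there is a single pair
`a, 2 * k - a` of gaps adding up to `2 * k`. -/
lemma exists_unique_gap_pair {H : Set ℕ} {k : ℕ} (hadd : ∀ a ∈ H, ∀ b ∈ H, a + b ∈ H)
    (hk : 2 * k ∉ H) (hF : ∀ n, 2 * k < n → n ∈ H) (hc : Hᶜ.ncard = k + 2) :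
    ∃ a < k, a ∉ H ∧ 2 * k - a ∉ H ∧
      ∀ x ≤ 2 * k, x ≠ a → x ≠ k → x ≠ 2 * k - a → (x ∈ H ↔ 2 * k - x ∉ H) := by
  classical
  have hsum : ∀ x ≤ 2 * k, x ∈ H → 2 * k - x ∉ H := fun x hx h h' => hk (by
    have := hadd _ h _ h'
    rwa [Nat.add_sub_cancel' hx] at this)
  have hcard := card_filter_mem_add_ncard_compl hF
  have hE := card_self_dual_gaps hsum rfl
  set E := ({x ∈ range (2 * k + 1) | x ∉ H ∧ 2 * k - x ∉ H} : Finset ℕ) with hEdef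
  have hE3 : #E = 3 := by omega
  have hmem : ∀ x, x ∈ E ↔ x ≤ 2 * k ∧ x ∉ H ∧ 2 * k - x ∉ H := by
    intro x
    simp [hEdef]
  have hflip : ∀ x ∈ E, 2 * k - x ∈ E := by
    intro x hx
    rw [hmem] at hx ⊢
    refine ⟨by omega, hx.2.2, ?_⟩
    rw [Nat.sub_sub_self hx.1]
    exact hx.2.1
  have hkE : k ∈ E := by
    have hkH : k ∉ H := fun h => hk (by simpa [two_mul] using hadd _ h _ h)
    rw [hmem]
    refine ⟨by omega, hkH, ?_⟩
    rwa [show 2 * k - k = k by omega]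
  obtain ⟨b, hb, hbk⟩ := exists_mem_ne (by omega : 1 < #E) k
  obtain ⟨a, ha, hak⟩ : ∃ a ∈ E, a < k := by
    rcases lt_or_gt_of_ne hbk with h | h
    · exact ⟨b, hb, h⟩
    · exact ⟨2 * k - b, hflip b hb, by omega⟩
  have hsub : ({a, k, 2 * k - a} : Finset ℕ) = E := by
    refine eq_of_subset_of_card_le ?_ ?_
    · have := hflip a ha
      intro x hx
      simp only [mem_insert, mem_singleton] at hx
      rcases hx with rfl | rfl | rfl <;> assumption
    · rw [hE3, card_eq_three.mpr ⟨a, k, 2 * k - a, by omega, by omega, by omega, rfl⟩]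
  refine ⟨a, hak, ((hmem a).1 ha).2.1, ((hmem a).1 ha).2.2, fun x hx h1 h2 h3 => ⟨hsum x hx, ?_⟩⟩
  intro h
  by_contra hxH
  have : x ∈ E := (hmem x).2 ⟨hx, hxH, h⟩
  rw [← hsub] at this
  simp only [mem_insert, mem_singleton] at this
  tauto

lemma mul_mem_of_add_mem {H : Set ℕ} (h0 : 0 ∈ H) (hadd : ∀ a ∈ H, ∀ b ∈ H, a + b ∈ H) {m : ℕ}
    (hm : m ∈ H) (j : ℕ) : m * j ∈ H := by
  induction j with
  | zero => simpa using h0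
  | succ j ih => exact hadd _ ih _ hm

/-- The half `k` of the Frobenius number is at most `5`. -/
lemma half_frobenius_le_five {H : Set ℕ} {k a : ℕ} (h0 : 0 ∈ H)
    (hadd : ∀ a ∈ H, ∀ b ∈ H, a + b ∈ H) (h1 : 1 ∉ H)
    (hk : 2 * k ∉ H) (hs : ∀ x < 2 * k, x ∈ H → x + 1 ∉ H) (ha : a < k)
    (hak : 2 * k - a ∉ H)
    (hsymm : ∀ x ≤ 2 * k, x ≠ a → x ≠ k → x ≠ 2 * k - a → (x ∈ H ↔ 2 * k - x ∉ H)) :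
    k ≤ 5 := by
  by_contra! hk5
  have h2 : 2 ∉ H := fun h => hk (mul_mem_of_add_mem h0 hadd h k)
  have hpair : ∀ x, x + 1 < k → x ∉ H → x + 1 ∉ H → a = x ∨ a = x + 1 := by
    intro x hx hxH hxH'
    by_contra! hne
    have e1 := hsymm x (by omega) (by omega) (by omega) (by omega)
    have e2 := hsymm (x + 1) (by omega) (by omega) (by omega) (by omega)
    have e3 := hs (2 * k - (x + 1)) (by omega) (by tauto)
    rw [show 2 * k - (x + 1) + 1 = 2 * k - x by omega] at e3
    tauto
  have p1 := hpair 1 (by omega) h1 h2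
  by_cases h3 : 3 ∈ H
  · have h4 : 4 ∉ H := hs 3 (by omega) h3
    have h5 : 5 ∉ H := fun h => hs 5 (by omega) h (hadd 3 h3 3 h3)
    have := hpair 4 (by omega) h4 h5
    omega
  · have p2 := hpair 2 (by omega) h2 h3
    by_cases h4 : 4 ∈ H
    · have ha2 : a = 2 := by omega
      subst ha2
      rcases Nat.even_or_odd' k with ⟨j, rfl | rfl⟩
      · exact hk (by simpa [← mul_assoc] using mul_mem_of_add_mem h0 hadd h4 j)
      · refine hak ?_
        rw [show 2 * (2 * j + 1) - 2 = 4 * j by omega]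
        exact mul_mem_of_add_mem h0 hadd h4 j
    · have := hpair 3 (by omega) h3 h4
      omega

lemma eq_union_of_forall_le {H : Set ℕ} {F : ℕ} {S : Set ℕ} (hF : ∀ n, F < n → n ∈ H)
    (hS : ∀ n ≤ F, n ∈ H ↔ n ∈ S) : H = S ∪ {n | F + 1 ≤ n} := by
  ext n
  have h1 := hF n
  have h2 := hS n
  simp only [Set.mem_union, Set.mem_ofPred_eq]
  by_cases h : F < n
  · simp [h1 h, Nat.succ_le_of_lt h]
  · have h' : ¬ F + 1 ≤ n := by omega
    simp [h2 (by omega), h']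

/-- **Theorem.** Let `H` be a sparse numerical semigroup of genus `g ≥ 4` with
Frobenius number `ℓ_g = 2g - 4`. Then `H` is one of:
(1) `{0,3,6} ∪ {n ≥ 9}` (i.e. `3ℕ + H_8`);
(2) `{0,3,6,9} ∪ {n ≥ 11}` (i.e. `3ℕ + H_10`);
(3) `{0,4} ∪ {n ≥ 7}` (i.e. `4ℕ + H_6`);
(4) `{0} ∪ {n ≥ 5}` (i.e. `H_4`);
(5) `{0,5} ∪ {n ≥ 7}` (i.e. `5ℕ + H_6`);
(6) `{0,5,7} ∪ {n ≥ 9}` (i.e. `{0,5,7} ∪ H_8`). -/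
theorem charact_frobenius_2g_sub_4 (H : Set ℕ) (g : ℕ) (hg : 4 ≤ g)
    (hH : IsNumericalSemigroupOfGenus H g) (hs : IsSparse H g)
    (hF : gap H g = 2 * g - 4) :
    H = ({0, 3, 6} : Set ℕ) ∪ {n : ℕ | 9 ≤ n} ∨
    H = ({0, 3, 6, 9} : Set ℕ) ∪ {n : ℕ | 11 ≤ n} ∨
    H = ({0, 4} : Set ℕ) ∪ {n : ℕ | 7 ≤ n} ∨
    H = ({0} : Set ℕ) ∪ {n : ℕ | 5 ≤ n} ∨
    H = ({0, 5} : Set ℕ) ∪ {n : ℕ | 7 ≤ n} ∨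
    H = ({0, 5, 7} : Set ℕ) ∪ {n : ℕ | 9 ≤ n} := by
  obtain ⟨h0, hadd, hfin, hc⟩ := hH
  obtain ⟨k, rfl⟩ : ∃ k, g = k + 2 := ⟨g - 2, by omega⟩
  have hF2 : gap H (k + 2) = 2 * k := by omega
  have hk : 2 * k ∉ H := hF2 ▸ gap_not_mem hfin (by omega)
  have hbig : ∀ n, 2 * k < n → n ∈ H := fun n hn =>
    mem_of_frobenius_lt hfin (by rwa [hc, hF2])
  have h1 : 1 ∉ H := fun h => hk (by simpa using mul_mem_of_add_mem h0 hadd h (2 * k))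
  have hsp : ∀ x < 2 * k, x ∈ H → x + 1 ∉ H := fun x hx =>
    succ_not_mem_of_isSparse hfin hc hs h1 (by rwa [hF2])
  obtain ⟨a, ha, haH, hakH, hsymm⟩ := exists_unique_gap_pair hadd hk hbig hc
  have hk5 := half_frobenius_le_five h0 hadd h1 hk hsp ha hakH hsymm
  have h2 : 2 ∉ H := fun h => hk (mul_mem_of_add_mem h0 hadd h k)
  have hk2 : 2 ≤ k := by omega
  have ha0 : a ≠ 0 := fun h => haH (h ▸ h0)
  clear hs hF hF2 hfin hc hg
  have hsymm1 := hsymm 1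
  have hsymm2 := hsymm 2
  have hsymm3 := hsymm 3
  have hsymm4 := hsymm 4
  have hkH : k ∉ H := fun h => hk (by simpa [two_mul] using hadd _ h _ h)
  have hsp3 := hsp 3
  have hsp5 := hsp 5
  have hsp6 := hsp 6
  have hsp7 := hsp 7
  have hsp8 := hsp 8
  have h33 : 3 ∈ H → 6 ∈ H := fun h => hadd 3 h 3 h
  have h36 : 3 ∈ H → 9 ∈ H := fun h => hadd 3 h 6 (h33 h)
  have h44 : 4 ∈ H → 8 ∈ H := fun h => hadd 4 h 4 h
  clear hsymm hsp hadd
  interval_cases k <;> interval_cases a <;>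
    simp only [Nat.reduceMul, Nat.reduceSub, Nat.reduceAdd] at * <;>
    try (exfalso; grind)
  · refine .inr (.inr (.inr (.inl ?_)))
    refine eq_union_of_forall_le hbig fun n hn => ?_
    interval_cases n <;> simp <;> grind
  · refine .inr (.inr (.inl ?_))
    refine eq_union_of_forall_le hbig fun n hn => ?_
    interval_cases n <;> simp <;> grind
  · refine .inr (.inr (.inr (.inr (.inl ?_))))
    refine eq_union_of_forall_le hbig fun n hn => ?_
    interval_cases n <;> simp <;> grind
  · refine .inl ?_
    refine eq_union_of_forall_le hbig fun n hn => ?_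
    interval_cases n <;> simp <;> grind
  · refine .inr (.inr (.inr (.inr (.inr (?_)))))
    refine eq_union_of_forall_le hbig fun n hn => ?_
    interval_cases n <;> simp <;> grind
  · refine .inr (.inl ?_)
    refine eq_union_of_forall_le hbig fun n hn => ?_
    interval_cases n <;> simp <;> grind
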